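/- arXiv:2408.07370 — 7 statements merged into one kernel-verified Lean document; each statement's English description precedes it below -/
import Mathlib

section
/- For a finite connected simple graph G without capacity constraints, x*(G) ≤ 1 if and only if G is acyclic and has diameter at most two. -/
open Finset

/-- An orientation of a simple graph `G`: `dir u v = true` means the edge `{u,v}`
is directed from `u` (tail) to `v` (head), i.e. the edge receives color `u`. -/
structure GraphOrientation {V : Type*} (G : SimpleGraph V) where
  dir : V → V → Bool
  adj_of_dir : ∀ u v, dir u v = true → G.Adj u v
  dir_iff : ∀ u v, G.Adj u v → (dir u v = true ↔ dir v u = false)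

variable {V : Type*} [Fintype V]

/-- The indegree of `v` under an orientation. -/
def GraphOrientation.indeg {G : SimpleGraph V} (Λ : GraphOrientation G) (v : V) : ℕ :=
  (univ.filter fun u => Λ.dir u v = true).card

/-- The outdegree of `v` under an orientation. -/
def GraphOrientation.outdeg {G : SimpleGraph V} (Λ : GraphOrientation G) (v : V) : ℕ :=
  (univ.filter fun u => Λ.dir v u = true).card

/-- The star value `x(G,Λ,v) = δ⁻(v) + (1 if δ⁺(v) > 0 else 0)`. -/
def GraphOrientation.starVal {G : SimpleGraph V} (Λ : GraphOrientation G) (v : V) : ℕ :=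
  Λ.indeg v + (if 0 < Λ.outdeg v then 1 else 0)

/-- `x(G,Λ) = max over vertices of the star value`. -/
def GraphOrientation.starMax {G : SimpleGraph V} (Λ : GraphOrientation G) : ℕ :=
  univ.sup fun v => Λ.starVal v

/-- The min-max star partitioning number `x*(G)` (no capacity constraints). -/
noncomputable def xStar (G : SimpleGraph V) : ℕ :=
  sInf {n | ∃ Λ : GraphOrientation G, Λ.starMax = n}

/-- Any edge avoiding `c` in an acyclic connected graph of diameter at most two contains a
neighbor of `c`. -/
theorem exists_adj_adj_of_adj_of_ne {W : Type*} {G : SimpleGraph W} (hc : G.Connected)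
    (ha : G.IsAcyclic) (hd : ∀ u v, G.dist u v ≤ 2) {c x y : W} (hxy : G.Adj x y)
    (hx : x ≠ c) (hy : y ≠ c) : ∃ x' y', G.Adj c x' ∧ G.Adj x' y' ∧ y' ≠ c := by
  have hne := (SimpleGraph.IsTree.mk hc ha).dist_ne_of_adj c hxy
  have hx0 : G.dist c x ≠ 0 := (hc.pos_dist_of_ne hx.symm).ne'
  have hy0 : G.dist c y ≠ 0 := (hc.pos_dist_of_ne hy.symm).ne'
  have hx2 := hd c x
  have hy2 := hd c y
  have : G.dist c x = 1 ∨ G.dist c y = 1 := by omega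
  rcases this with h | h
  · exact ⟨x, y, SimpleGraph.dist_eq_one_iff_adj.mp h, hxy, hy⟩
  · exact ⟨y, x, SimpleGraph.dist_eq_one_iff_adj.mp h, hxy.symm, hx⟩

/-- In an acyclic graph of diameter at most two there is no path of length three. -/
theorem eq_of_adj_of_adj_of_adj {W : Type*} {G : SimpleGraph W} (hc : G.Connected)
    (ha : G.IsAcyclic) (hd : ∀ u v, G.dist u v ≤ 2) {a c x y : W} (hac : G.Adj a c)
    (hcx : G.Adj c x) (hxy : G.Adj x y) (hyc : y ≠ c) : a = x := by
  by_contra hax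
  have hT : G.IsTree := ⟨hc, ha⟩
  have hac1 : G.dist a c = 1 := SimpleGraph.dist_eq_one_iff_adj.mpr hac
  have h1 := hT.dist_ne_of_adj a hcx
  have h2 := hT.dist_ne_of_adj a hxy
  have h3 := hT.dist_ne_of_adj c hxy
  have hcx1 : G.dist c x = 1 := SimpleGraph.dist_eq_one_iff_adj.mpr hcx
  have hx0 := hc.pos_dist_of_ne hax
  have hx2 := hd a x
  have hy2 := hd a y
  have hya : a ≠ y := by
    rintro rfl
    exact h3 (hcx1.trans (SimpleGraph.dist_eq_one_iff_adj.mpr hac.symm).symm)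
  have hy0 := hc.pos_dist_of_ne hya
  have hay : G.Adj a y := SimpleGraph.dist_eq_one_iff_adj.mp (by omega)
  have hp : (SimpleGraph.Walk.cons hac.symm (.cons hay .nil)).IsPath := by
    simp [hac.ne', hyc.symm, hya]
  have hq : (SimpleGraph.Walk.cons hcx (.cons hxy .nil)).IsPath := by
    simp [hcx.ne, hyc.symm, hxy.ne]
  have h := (ha.subsingleton_path c y).elim ⟨_, hp⟩ ⟨_, hq⟩
  simp only [Subtype.mk.injEq, SimpleGraph.Walk.cons.injEq] at h
  exact hax h.1

/-- A connected acyclic graph of diameter at most two is contained in a star. -/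
theorem exists_le_starGraph {W : Type*} {G : SimpleGraph W} (hc : G.Connected)
    (ha : G.IsAcyclic) (hd : ∀ u v, G.dist u v ≤ 2) : ∃ c, G ≤ SimpleGraph.starGraph c := by
  by_cases h : ∃ c a b, G.Adj a c ∧ G.Adj b c ∧ a ≠ b
  · obtain ⟨c, a, b, hac, hbc, hab⟩ := h
    refine ⟨c, fun u v huv ↦ SimpleGraph.starGraph_adj.mpr ⟨huv.ne, ?_⟩⟩
    by_contra! hn
    obtain ⟨x, y, hcx, hxy, hy⟩ := exists_adj_adj_of_adj_of_ne hc ha hd huv hn.1 hn.2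
    exact hab ((eq_of_adj_of_adj_of_adj hc ha hd hac hcx hxy hy).trans
      (eq_of_adj_of_adj_of_adj hc ha hd hbc hcx hxy hy).symm)
  · obtain ⟨c⟩ := hc.nonempty
    refine ⟨c, fun u v huv ↦ SimpleGraph.starGraph_adj.mpr ⟨huv.ne, ?_⟩⟩
    by_contra! hn
    obtain ⟨x, y, hcx, hxy, hy⟩ := exists_adj_adj_of_adj_of_ne hc ha hd huv hn.1 hn.2
    exact h ⟨x, c, y, hcx, hxy.symm, hy.symm⟩

/-- A connected graph contained in a star has diameter at most two. -/
theorem dist_le_two_of_le_starGraph {W : Type*} {G : SimpleGraph W} (hc : G.Connected) {c : W}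
    (hG : G ≤ SimpleGraph.starGraph c) (u v : W) : G.dist u v ≤ 2 := by
  have key : ∀ w, G.dist w c ≤ 1 := by
    intro w
    by_cases hw : w = c
    · simp [hw]
    · have : Nontrivial W := ⟨w, c, hw⟩
      obtain ⟨z, hz⟩ := hc.preconnected.exists_adj_of_nontrivial w
      rcases (SimpleGraph.starGraph_adj.mp (hG hz)).2 with h | rfl
      · exact absurd h hw
      · exact (SimpleGraph.dist_eq_one_iff_adj.mpr hz).le
  have h1 := hc.dist_triangle (u := u) (v := c) (w := v)
  have h2 := key u
  have h3 := key v
  rw [SimpleGraph.dist_comm] at h3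
  omega

namespace GraphOrientation

variable {G : SimpleGraph V} (Λ : GraphOrientation G)

theorem starVal_le_one_iff (v : V) :
    Λ.starVal v ≤ 1 ↔ (∀ a b, Λ.dir a v = true → Λ.dir b v = true → a = b) ∧
      ∀ a b, Λ.dir a v = true → ¬ Λ.dir v b = true := by
  have hin : Λ.indeg v ≤ 1 ↔ ∀ a b, Λ.dir a v = true → Λ.dir b v = true → a = b := by
    simp only [indeg, Finset.card_le_one, mem_filter, mem_univ, true_and]
    exact ⟨fun h a b ha hb ↦ h a ha b hb, fun h a ha b hb ↦ h a b ha hb⟩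
  have hin0 : 0 < Λ.indeg v ↔ ∃ a, Λ.dir a v = true := by
    simp [indeg, Finset.card_pos, Finset.Nonempty]
  have hout : 0 < Λ.outdeg v ↔ ∃ b, Λ.dir v b = true := by
    simp [outdeg, Finset.card_pos, Finset.Nonempty]
  have hio : (∀ a b, Λ.dir a v = true → ¬ Λ.dir v b = true) ↔
      ¬ (0 < Λ.indeg v ∧ 0 < Λ.outdeg v) := by
    rw [hin0, hout]
    exact ⟨fun h ⟨⟨a, ha⟩, b, hb⟩ ↦ h a b ha hb, fun h a b ha hb ↦ h ⟨⟨a, ha⟩, b, hb⟩⟩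
  rw [← hin, hio, starVal]
  split_ifs <;> omega

theorem starMax_le_one_iff : Λ.starMax ≤ 1 ↔ ∀ v, Λ.starVal v ≤ 1 := by
  simp [starMax, Finset.sup_le_iff]

theorem dir_or_dir {W : Type*} {G : SimpleGraph W} (Λ : GraphOrientation G) {u v : W} (h : G.Adj u v) : Λ.dir u v = true ∨ Λ.dir v u = true := by
  have := Λ.dir_iff u v h
  cases hv : Λ.dir v u <;> simp_all

/-- The underlying graph of an orientation of star value at most one is contained in a star. -/
theorem exists_le_starGraph_of_starMax_le_one (hc : G.Connected) (h : Λ.starMax ≤ 1) :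
    ∃ c, G ≤ SimpleGraph.starGraph c := by
  have hv := fun v ↦ (Λ.starVal_le_one_iff v).mp (Λ.starMax_le_one_iff.mp h v)
  by_cases he : ∃ c d, Λ.dir c d = true
  · obtain ⟨c, d, hcd⟩ := he
    have key : ∀ w, w = c ∨ Λ.dir c w = true := by
      intro w
      obtain ⟨p⟩ := (hc.preconnected w c)
      induction p with
      | nil => exact Or.inl rfl
      | cons hadj _ ih =>
        rcases ih hcd with rfl | h' <;> rcases Λ.dir_or_dir hadj with h1 | h1
        · exact absurd hcd ((hv _).2 _ _ h1)
        · exact Or.inr h1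
        · exact Or.inl ((hv _).1 _ _ h1 h')
        · exact absurd h1 ((hv _).2 _ _ h')
    refine ⟨c, fun u v huv ↦ SimpleGraph.starGraph_adj.mpr ⟨huv.ne, ?_⟩⟩
    rcases key u with hu | hu
    · exact Or.inl hu
    rcases key v with hw | hw
    · exact Or.inr hw
    rcases Λ.dir_or_dir huv with h1 | h1
    · exact absurd h1 ((hv _).2 _ _ hu)
    · exact absurd h1 ((hv _).2 _ _ hw)
  · obtain ⟨c⟩ := hc.nonempty
    refine ⟨c, fun u v huv ↦ ?_⟩
    rcases Λ.dir_or_dir huv with h1 | h1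
    · exact absurd ⟨_, _, h1⟩ he
    · exact absurd ⟨_, _, h1⟩ he

open Classical in
/-- The orientation of a subgraph of a star away from its center. -/
noncomputable def ofLeStarGraph {W : Type*} {G : SimpleGraph W} {c : W}
    (hG : G ≤ SimpleGraph.starGraph c) : GraphOrientation G where
  dir u v := decide (u = c ∧ G.Adj u v)
  adj_of_dir u v h := (of_decide_eq_true h).2
  dir_iff u v h := by
    have h1 := SimpleGraph.starGraph_adj.mp (hG h)
    have h2 := h.symm
    simp only [decide_eq_true_eq, decide_eq_false_iff_not, h, h2, and_true]
    grind

theorem starMax_ofLeStarGraph_le_one {c : V} (hG : G ≤ SimpleGraph.starGraph c) :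
    (ofLeStarGraph hG).starMax ≤ 1 := by
  refine (starMax_le_one_iff _).mpr fun v ↦ (starVal_le_one_iff _ v).mpr ⟨?_, ?_⟩
  · intro a b ha hb
    simp only [ofLeStarGraph, decide_eq_true_eq] at ha hb
    exact ha.1.trans hb.1.symm
  · intro a b ha hb
    simp only [ofLeStarGraph, decide_eq_true_eq] at ha hb
    exact ha.2.ne (ha.1.trans hb.1.symm)

theorem nonempty {W : Type*} (G : SimpleGraph W) : Nonempty (GraphOrientation G) := by
  classical
  obtain ⟨_⟩ : Nonempty (LinearOrder W) := ⟨linearOrderOfSTO WellOrderingRel⟩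
  refine ⟨⟨fun u v ↦ decide (u < v ∧ G.Adj u v), fun u v h ↦ (of_decide_eq_true h).2, ?_⟩⟩
  intro u v h
  have h2 := h.symm
  have h3 := h.ne
  simp only [decide_eq_true_eq, decide_eq_false_iff_not, h, h2, and_true, not_lt]
  exact ⟨le_of_lt, fun h' ↦ lt_of_le_of_ne h' h3⟩

end GraphOrientation

theorem xStar_le_one_iff (G : SimpleGraph V) :
    xStar G ≤ 1 ↔ ∃ Λ : GraphOrientation G, Λ.starMax ≤ 1 := by
  constructor
  · intro h
    obtain ⟨Λ₀⟩ := GraphOrientation.nonempty G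
    obtain ⟨Λ, hΛ⟩ := Nat.sInf_mem (s := {n | ∃ Λ : GraphOrientation G, Λ.starMax = n})
      ⟨_, Λ₀, rfl⟩
    exact ⟨Λ, hΛ.trans_le h⟩
  · rintro ⟨Λ, h⟩
    have hle : xStar G ≤ Λ.starMax := Nat.sInf_le ⟨Λ, rfl⟩
    exact hle.trans h

/-- For a finite connected simple graph `G`, `x*(G) ≤ 1` iff `G` is
acyclic and has diameter at most two. -/
theorem stmt1 (G : SimpleGraph V) (hc : G.Connected) :
    xStar G ≤ 1 ↔ G.IsAcyclic ∧ ∀ u v : V, G.dist u v ≤ 2 := by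
  rw [xStar_le_one_iff]
  constructor
  · rintro ⟨Λ, h⟩
    obtain ⟨c, hG⟩ := Λ.exists_le_starGraph_of_starMax_le_one hc h
    exact ⟨(SimpleGraph.isAcyclic_starGraph c).anti hG, dist_le_two_of_le_starGraph hc hG⟩
  · rintro ⟨ha, hd⟩
    obtain ⟨c, hG⟩ := exists_le_starGraph hc ha hd
    exact ⟨_, GraphOrientation.starMax_ofLeStarGraph_le_one hG⟩
end

section
/- Every finite connected simple graph G with |E| ≤ |V| (i.e. containing at most one cycle) and without capacity constraints satisfies x*(G) ≤ 2. -/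
open Finset

variable {V : Type*} [Fintype V]

/-- In a connected graph, every vertex other than the root `r` has a neighbour closer to `r`. -/
theorem SimpleGraph.Connected.exists_adj_dist_lt {W : Type*} {T : SimpleGraph W}
    (hT : T.Connected) {r v : W} (hv : v ≠ r) : ∃ u, T.Adj v u ∧ T.dist u r < T.dist v r := by
  obtain ⟨p, hp⟩ := hT.exists_walk_length_eq_dist v r
  cases p with
  | nil => exact absurd rfl hv
  | cons h q =>
    refine ⟨_, h, ?_⟩
    have := SimpleGraph.dist_le q
    rw [SimpleGraph.Walk.length_cons] at hp
    omega

/-- In a finite tree with root `r`, each edge can be written `s(v, f v)` with `v ≠ r`,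
where `f` is the parent map. -/
theorem SimpleGraph.IsTree.exists_parent {W : Type*} [Fintype W] {T : SimpleGraph W}
    (hT : T.IsTree) (r : W) :
    ∃ f : W → W, ∀ e ∈ T.edgeSet, ∃ v, v ≠ r ∧ s(v, f v) = e := by
  classical
  have hparent : ∀ v, ∃ u, v ≠ r → T.Adj v u ∧ T.dist u r < T.dist v r := fun v => by
    by_cases hv : v = r
    · exact ⟨v, fun h => absurd hv h⟩
    · obtain ⟨u, hu⟩ := hT.connected.exists_adj_dist_lt hv
      exact ⟨u, fun _ => hu⟩
  choose f hf using hparent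
  have hinj : Set.InjOn (fun v => s(v, f v)) (univ.erase r : Finset W) := by
    intro v hv w hw h
    have hv := hf v (Finset.ne_of_mem_erase hv)
    have hw := hf w (Finset.ne_of_mem_erase hw)
    rcases Sym2.eq_iff.1 h with ⟨h, -⟩ | ⟨h₁, h₂⟩
    · exact h
    · rw [h₂] at hv
      rw [← h₁] at hw
      omega
  have himage : (univ.erase r).image (fun v => s(v, f v)) = T.edgeFinset := by
    apply Finset.eq_of_subset_of_card_le
    · intro e he
      obtain ⟨v, hv, rfl⟩ := Finset.mem_image.1 he
      simpa using (hf v (Finset.ne_of_mem_erase hv)).1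
    · rw [Finset.card_image_of_injOn hinj, Finset.card_erase_of_mem (mem_univ r),
        Finset.card_univ]
      have := hT.card_edgeFinset
      omega
  refine ⟨f, fun e he => ?_⟩
  rw [← SimpleGraph.mem_edgeFinset, ← himage] at he
  obtain ⟨v, hv, h⟩ := Finset.mem_image.1 he
  exact ⟨v, Finset.ne_of_mem_erase hv, h⟩

/-- A connected graph with at most as many edges as vertices admits an injective assignment
of an endpoint to each edge. -/
theorem SimpleGraph.Connected.exists_injOn_head {W : Type*} [Fintype W] {G : SimpleGraph W}
    [DecidableRel G.Adj] (hc : G.Connected) (hE : G.edgeFinset.card ≤ Fintype.card W) :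
    ∃ head : Sym2 W → W, (∀ e ∈ G.edgeSet, head e ∈ e) ∧ Set.InjOn head G.edgeSet := by
  classical
  obtain ⟨T, hTG, hT⟩ := hc.exists_isTree_le
  have hcard : (G.edgeFinset \ T.edgeFinset).card ≤ 1 := by
    rw [Finset.card_sdiff_of_subset (SimpleGraph.edgeFinset_mono hTG)]
    have := hT.card_edgeFinset
    omega
  have hunique : ∀ e ∈ G.edgeSet, ∀ e' ∈ G.edgeSet, e ∉ T.edgeSet → e' ∉ T.edgeSet → e = e' :=
    fun e he e' he' h h' => Finset.card_le_one.1 hcard e (by simp [he, h]) e' (by simp [he', h'])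
  obtain ⟨r, hr⟩ : ∃ r, ∀ e ∈ G.edgeSet, e ∉ T.edgeSet → r ∈ e := by
    by_cases h : ∃ e ∈ G.edgeSet, e ∉ T.edgeSet
    · obtain ⟨e, he, heT⟩ := h
      exact ⟨e.out.1, fun e' he' he'T => hunique e he e' he' heT he'T ▸ Sym2.out_fst_mem e⟩
    · exact ⟨hc.nonempty.some, fun e he heT => absurd ⟨e, he, heT⟩ h⟩
  obtain ⟨f, hf⟩ := hT.exists_parent r
  have hhead : ∀ e, ∃ v, e ∈ G.edgeSet →
      v ∈ e ∧ ((v ≠ r ∧ s(v, f v) = e) ∨ (v = r ∧ e ∉ T.edgeSet)) := by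
    intro e
    by_cases he : e ∈ T.edgeSet
    · obtain ⟨v, hv, rfl⟩ := hf e he
      exact ⟨v, fun _ => ⟨Sym2.mem_mk_left _ _, .inl ⟨hv, rfl⟩⟩⟩
    · exact ⟨r, fun h => ⟨hr e h he, .inr ⟨rfl, he⟩⟩⟩
  choose head hhead using hhead
  refine ⟨head, fun e he => (hhead e he).1, fun e he e' he' h => ?_⟩
  rcases (hhead e he).2 with ⟨h₁, h₂⟩ | ⟨h₁, h₂⟩ <;>
    rcases (hhead e' he').2 with ⟨h₃, h₄⟩ | ⟨h₃, h₄⟩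
  · rw [← h₂, ← h₄, h]
  · exact absurd (h.trans h₃) h₁
  · exact absurd (h.symm.trans h₁) h₃
  · exact hunique e he e' he' h₂ h₄

/-- The orientation directing each edge towards a chosen endpoint. -/
noncomputable def GraphOrientation.ofHead {W : Type*} {G : SimpleGraph W} (head : Sym2 W → W)
    (hmem : ∀ e ∈ G.edgeSet, head e ∈ e) : GraphOrientation G := by
  classical
  exact
  { dir := fun u v => decide (G.Adj u v ∧ head s(u, v) = v)
    adj_of_dir := fun u v h => (of_decide_eq_true h).1
    dir_iff := fun u v h => by
      have hm := Sym2.mem_iff.1 (hmem s(u, v) h)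
      have hne := h.ne
      simp only [decide_eq_true_eq, decide_eq_false_iff_not, Sym2.eq_swap (a := v), h, h.symm,
        true_and]
      grind }

theorem GraphOrientation.ofHead_dir {W : Type*} {G : SimpleGraph W} {head : Sym2 W → W}
    {hmem : ∀ e ∈ G.edgeSet, head e ∈ e} {u v : W} :
    (ofHead head hmem).dir u v = true ↔ G.Adj u v ∧ head s(u, v) = v := by
  simp [ofHead]

theorem GraphOrientation.indeg_ofHead_le_one {W : Type*} [Fintype W] {G : SimpleGraph W}
    {head : Sym2 W → W} (hmem : ∀ e ∈ G.edgeSet, head e ∈ e) (hinj : Set.InjOn head G.edgeSet)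
    (v : W) : (ofHead head hmem).indeg v ≤ 1 := by
  refine Finset.card_le_one.2 fun u hu w hw => ?_
  obtain ⟨hu, hu'⟩ := ofHead_dir.1 (Finset.mem_filter.1 hu).2
  obtain ⟨hw, hw'⟩ := ofHead_dir.1 (Finset.mem_filter.1 hw).2
  exact Sym2.congr_left.1 (hinj hu hw (hu'.trans hw'.symm))

/-- Every finite connected simple graph with `|E| ≤ |V|` satisfies `x*(G) ≤ 2`. -/
theorem stmt3 (G : SimpleGraph V) [DecidableRel G.Adj] (hc : G.Connected)
    (hE : G.edgeFinset.card ≤ Fintype.card V) :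
    xStar G ≤ 2 := by
  obtain ⟨head, hmem, hinj⟩ := hc.exists_injOn_head hE
  have hle : xStar G ≤ (GraphOrientation.ofHead head hmem).starMax := Nat.sInf_le ⟨_, rfl⟩
  refine hle.trans (Finset.sup_le fun v _ => ?_)
  have := GraphOrientation.indeg_ofHead_le_one hmem hinj v
  unfold GraphOrientation.starVal
  split_ifs <;> omega
end

section
/- For every integer n ≥ 2, the complete bipartite graph K_{n,n} without capacity constraints satisfies x*(K_{n,n}) = ⌈n/2⌉ + 1. -/
open Finset

variable {V : Type*} [Fintype V]

namespace GraphOrientation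

lemma sum_indeg_eq_sum_outdeg {G : SimpleGraph V} (Λ : GraphOrientation G) :
    ∑ v, Λ.indeg v = ∑ v, Λ.outdeg v := by
  simp only [indeg, outdeg, card_filter]
  exact sum_comm

lemma exists_outdeg_le_indeg [Nonempty V] {G : SimpleGraph V} (Λ : GraphOrientation G) :
    ∃ v, Λ.outdeg v ≤ Λ.indeg v := by
  obtain ⟨v, -, hv⟩ := exists_le_of_sum_le univ_nonempty Λ.sum_indeg_eq_sum_outdeg.ge
  exact ⟨v, hv⟩

lemma indeg_add_outdeg {G : SimpleGraph V} [DecidableRel G.Adj] (Λ : GraphOrientation G) (v : V) :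
    Λ.indeg v + Λ.outdeg v = G.degree v := by
  rw [← G.card_neighborFinset_eq_degree, G.neighborFinset_eq_filter]
  simp only [indeg, outdeg, card_filter]
  rw [← sum_add_distrib]
  refine sum_congr rfl fun u _ => ?_
  have h₁ := Λ.adj_of_dir u v
  have h₂ := Λ.adj_of_dir v u
  have h₃ := Λ.dir_iff v u
  have h₄ := G.adj_comm u v
  grind

lemma starVal_le_starMax {G : SimpleGraph V} (Λ : GraphOrientation G) (v : V) :
    Λ.starVal v ≤ Λ.starMax :=
  le_sup (f := Λ.starVal) (mem_univ v)

/-- The orientation of `K_{n,n}` directing the edge between `i` and `j` from left to right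
exactly when `i + j` is even. -/
def parity (n : ℕ) : GraphOrientation (completeBipartiteGraph (Fin n) (Fin n)) where
  dir
    | .inl i, .inr j => decide ((i.val + j.val) % 2 = 0)
    | .inr j, .inl i => decide ((i.val + j.val) % 2 = 1)
    | _, _ => false
  adj_of_dir u v h := by
    rcases u with u | u <;> rcases v with v | v <;> simp_all
  dir_iff u v h := by
    rcases u with u | u <;> rcases v with v | v <;> simp_all

end GraphOrientation

lemma degree_completeBipartiteGraph_fin (n : ℕ)
    [DecidableRel (completeBipartiteGraph (Fin n) (Fin n)).Adj] (v : Fin n ⊕ Fin n) :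
    (completeBipartiteGraph (Fin n) (Fin n)).degree v = n := by
  rw [← SimpleGraph.card_neighborFinset_eq_degree, SimpleGraph.neighborFinset_eq_filter,
    card_filter, Fintype.sum_sum_type]
  rcases v with v | v <;> simp

lemma card_filter_add_mod_two_le (n j r : ℕ) :
    (univ.filter fun i : Fin n => (i.val + j) % 2 = r).card ≤ (n + 1) / 2 := by
  rw [card_filter, Fin.sum_univ_eq_sum_range (fun i => if (i + j) % 2 = r then 1 else 0)]
  induction n using Nat.twoStepInduction with
  | zero => simp
  | one => simp only [sum_range_one]; split_ifs <;> omega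
  | more n ih _ =>
    rw [sum_range_succ, sum_range_succ]
    split_ifs <;> omega

lemma GraphOrientation.indeg_parity_le (n : ℕ) (v : Fin n ⊕ Fin n) :
    (parity n).indeg v ≤ (n + 1) / 2 := by
  rw [indeg, card_filter, Fintype.sum_sum_type]
  rcases v with v | v
  · simpa [parity, add_comm] using card_filter_add_mod_two_le n v 1
  · simpa [parity] using card_filter_add_mod_two_le n v 0

/-- For `n ≥ 2`, `x*(K_{n,n}) = ⌈n/2⌉ + 1`. -/
theorem stmt4 (n : ℕ) (hn : 2 ≤ n) :
    xStar (completeBipartiteGraph (Fin n) (Fin n)) = (n + 1) / 2 + 1 := by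
  classical
  apply le_antisymm
  · refine le_trans (b := (GraphOrientation.parity n).starMax) (Nat.sInf_le ⟨_, rfl⟩)
      (Finset.sup_le fun v _ => ?_)
    have := GraphOrientation.indeg_parity_le n v
    unfold GraphOrientation.starVal
    split_ifs <;> omega
  · refine le_csInf ⟨_, GraphOrientation.parity n, rfl⟩ ?_
    rintro _ ⟨Λ, rfl⟩
    have : Nonempty (Fin n ⊕ Fin n) := ⟨.inl ⟨0, by omega⟩⟩
    obtain ⟨v, hv⟩ := Λ.exists_outdeg_le_indeg
    refine le_trans ?_ (Λ.starVal_le_starMax v)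
    have h := Λ.indeg_add_outdeg v
    rw [degree_completeBipartiteGraph_fin] at h
    unfold GraphOrientation.starVal
    split_ifs <;> omega
end

section
/- For every finite simple graph G without capacity constraints, there exists a single orientation Λ of G that is simultaneously optimal for both problems: k(G,Λ) = max_v δ⁻_Λ(v) = k*(G) and x(G,Λ) = x*(G). -/
open Finset

variable {V : Type*} [Fintype V]

/-- `k(G,Λ) = max over vertices of the indegree`. -/
def GraphOrientation.indegMax {G : SimpleGraph V} (Λ : GraphOrientation G) : ℕ :=
  univ.sup fun v => Λ.indeg v

/-- The min-max indegree number `k*(G)` (no capacity constraints). -/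
noncomputable def kStar (G : SimpleGraph V) : ℕ :=
  sInf {n | ∃ Λ : GraphOrientation G, Λ.indegMax = n}

open Classical in
/-- Orienting every edge along an enumeration of the vertices. -/
noncomputable def GraphOrientation.ofEquivFin (G : SimpleGraph V) : GraphOrientation G where
  dir u v := decide (G.Adj u v ∧ Fintype.equivFin V u < Fintype.equivFin V v)
  adj_of_dir u v h := (of_decide_eq_true h).1
  dir_iff u v h := by
    have hne : Fintype.equivFin V u ≠ Fintype.equivFin V v := fun he =>
      h.ne ((Fintype.equivFin V).injective he)
    simp only [decide_eq_true_eq, decide_eq_false_iff_not, h, h.symm, true_and, not_lt]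
    exact ⟨le_of_lt, fun hle => lt_of_le_of_ne hle hne⟩

theorem GraphOrientation.indegMax_le_starMax {G : SimpleGraph V} (Λ : GraphOrientation G) :
    Λ.indegMax ≤ Λ.starMax :=
  Finset.sup_mono_fun fun _ _ => Nat.le_add_right _ _

theorem GraphOrientation.starMax_le_indegMax_add_one {G : SimpleGraph V}
    (Λ : GraphOrientation G) : Λ.starMax ≤ Λ.indegMax + 1 :=
  Finset.sup_le fun v hv =>
    Nat.add_le_add (Finset.le_sup (f := fun v => Λ.indeg v) hv) (by split <;> simp)

theorem exists_indegMax_eq_kStar (G : SimpleGraph V) :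
    ∃ Λ : GraphOrientation G, Λ.indegMax = kStar G :=
  Nat.sInf_mem (s := {n | ∃ Λ : GraphOrientation G, Λ.indegMax = n})
    ⟨_, GraphOrientation.ofEquivFin G, rfl⟩

theorem exists_starMax_eq_xStar (G : SimpleGraph V) :
    ∃ Λ : GraphOrientation G, Λ.starMax = xStar G :=
  Nat.sInf_mem (s := {n | ∃ Λ : GraphOrientation G, Λ.starMax = n})
    ⟨_, GraphOrientation.ofEquivFin G, rfl⟩

theorem GraphOrientation.kStar_le_indegMax {G : SimpleGraph V} (Λ : GraphOrientation G) :
    kStar G ≤ Λ.indegMax :=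
  Nat.sInf_le ⟨Λ, rfl⟩

theorem GraphOrientation.xStar_le_starMax {G : SimpleGraph V} (Λ : GraphOrientation G) :
    xStar G ≤ Λ.starMax :=
  Nat.sInf_le ⟨Λ, rfl⟩

/-- There is a single orientation simultaneously optimal for both
the min-max indegree problem and the min-max star partitioning problem. -/
theorem stmt7 (G : SimpleGraph V) :
    ∃ Λ : GraphOrientation G, Λ.indegMax = kStar G ∧ Λ.starMax = xStar G := by
  rcases le_or_gt (xStar G) (kStar G) with h | h
  · obtain ⟨Λ, hΛ⟩ := exists_starMax_eq_xStar G
    exact ⟨Λ, le_antisymm (Λ.indegMax_le_starMax.trans (hΛ.le.trans h)) Λ.kStar_le_indegMax, hΛ⟩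
  · obtain ⟨Λ, hΛ⟩ := exists_indegMax_eq_kStar G
    refine ⟨Λ, hΛ, le_antisymm (Λ.starMax_le_indegMax_add_one.trans ?_) Λ.xStar_le_starMax⟩
    rw [hΛ]
    exact h
end

section
/- Let G = (V,E) be a finite simple graph with capacities κ_v ∈ ℕ, let x ∈ ℕ, and for each vertex v define l(v,x) := max{0, δ(v) − min{κ_v, x} + 1}. Then x*(G) ≤ x if and only if there exists an orientation Λ of G such that δ⁺_Λ(v) ≥ l(v,x) for every vertex v with l(v,x) > 1. -/
open Finset

variable {V : Type*} [Fintype V]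

/-- The min-max star partitioning number `x*(G)` with capacities `κ`:
an orientation is valid if every star value respects the capacity;
the value is `∞` (i.e. `⊤ : ℕ∞`) if no valid orientation exists. -/
noncomputable def xStarCap (G : SimpleGraph V) (κ : V → ℕ) : ℕ∞ :=
  sInf {n : ℕ∞ | ∃ Λ : GraphOrientation G,
    (∀ v, Λ.starVal v ≤ κ v) ∧ (Λ.starMax : ℕ∞) = n}

/-- `l(v,x) = max {0, δ(v) - min {κ_v, x} + 1}` (the natural subtraction
`δ(v) + 1 - min {κ_v, x}` agrees with the integer formula). -/
def lowerBd (G : SimpleGraph V) [DecidableRel G.Adj] (κ : V → ℕ) (x : ℕ) (v : V) : ℕ :=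
  G.degree v + 1 - min (κ v) x

/-- Every edge at `v` is either incoming or outgoing. -/
theorem GraphOrientation.indeg_add_outdeg_s8 {G : SimpleGraph V} [DecidableRel G.Adj]
    (Λ : GraphOrientation G) (v : V) : Λ.indeg v + Λ.outdeg v = G.degree v := by
  classical
  unfold GraphOrientation.indeg GraphOrientation.outdeg
  rw [← card_union_of_disjoint, ← G.card_neighborFinset_eq_degree]
  · congr 1
    ext u
    simp only [mem_union, mem_filter, mem_univ, true_and, SimpleGraph.mem_neighborFinset]
    constructor
    · rintro (h | h)
      · exact (Λ.adj_of_dir _ _ h).symm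
      · exact Λ.adj_of_dir _ _ h
    · intro h
      rw [Λ.dir_iff u v h.symm]
      cases Λ.dir v u <;> simp
  · rw [disjoint_filter]
    intro u _ h h'
    rw [(Λ.dir_iff u v (Λ.adj_of_dir _ _ h)).1 h] at h'
    exact Bool.false_ne_true h'

theorem GraphOrientation.starVal_le_min_iff {G : SimpleGraph V} [DecidableRel G.Adj]
    (Λ : GraphOrientation G) (κ : V → ℕ) (x : ℕ) (v : V) :
    Λ.starVal v ≤ min (κ v) x ↔ (1 < lowerBd G κ x v → lowerBd G κ x v ≤ Λ.outdeg v) := by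
  have h := Λ.indeg_add_outdeg_s8 v
  unfold GraphOrientation.starVal lowerBd
  generalize min (κ v) x = m
  split_ifs <;> omega

theorem xStarCap_le_iff (G : SimpleGraph V) (κ : V → ℕ) (x : ℕ) :
    xStarCap G κ ≤ (x : ℕ∞) ↔
      ∃ Λ : GraphOrientation G, ∀ v, Λ.starVal v ≤ min (κ v) x := by
  unfold xStarCap
  constructor
  · intro h
    have hlt := lt_of_le_of_lt h (Nat.cast_lt.2 x.lt_succ_self)
    obtain ⟨_, ⟨Λ, hκ, rfl⟩, hx⟩ := sInf_lt_iff.1 hlt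
    have hmax : Λ.starMax ≤ x := Nat.lt_succ_iff.1 (Nat.cast_lt.1 hx)
    exact ⟨Λ, fun v => le_min (hκ v) (Finset.sup_le_iff.1 hmax v (mem_univ v))⟩
  · rintro ⟨Λ, h⟩
    have hmax : Λ.starMax ≤ x := Finset.sup_le fun v _ => (h v).trans (min_le_right _ _)
    exact sInf_le_of_le ⟨Λ, fun v => (h v).trans (min_le_left _ _), rfl⟩ (Nat.cast_le.2 hmax)

/-- `x*(G) ≤ x` iff there is an orientation such that every vertex `v`
with `l(v,x) > 1` has outdegree at least `l(v,x)`. -/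
theorem stmt8 (G : SimpleGraph V) [DecidableRel G.Adj] (κ : V → ℕ) (x : ℕ) :
    xStarCap G κ ≤ (x : ℕ∞) ↔
      ∃ Λ : GraphOrientation G,
        ∀ v, 1 < lowerBd G κ x v → lowerBd G κ x v ≤ Λ.outdeg v := by
  simp only [xStarCap_le_iff, GraphOrientation.starVal_le_min_iff]
end

section
/- Let G = (V,E) be a finite simple graph in which every vertex v has a weight w_v > 0, without capacity constraints. Define k*(G) := min over all orientations Λ of k(G,Λ) and x*(G) := min over all orientations Λ of x(G,Λ). Then k*(G) ≤ x*(G) ≤ 2 · k*(G). -/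
open Finset

variable {V : Type*} [Fintype V]

/-- The weighted indegree `k(G,Λ,v)`: the sum of the weights of the tails of the
edges directed toward `v`. -/
def GraphOrientation.wIndeg {G : SimpleGraph V} (Λ : GraphOrientation G)
    (w : V → ℝ) (v : V) : ℝ :=
  ∑ u ∈ univ.filter (fun u => Λ.dir u v = true), w u

/-- The weighted star value `x(G,Λ,v) = k(G,Λ,v) + (w_v if v has an outgoing edge)`. -/
def GraphOrientation.wStarVal {G : SimpleGraph V} (Λ : GraphOrientation G)
    (w : V → ℝ) (v : V) : ℝ :=
  Λ.wIndeg w v + (if 0 < Λ.outdeg v then w v else 0)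

/-- `k(G,Λ) = max over vertices of the weighted indegree`. -/
noncomputable def GraphOrientation.wIndegMax [Nonempty V] {G : SimpleGraph V}
    (Λ : GraphOrientation G) (w : V → ℝ) : ℝ :=
  univ.sup' univ_nonempty (Λ.wIndeg w)

/-- `x(G,Λ) = max over vertices of the weighted star value`. -/
noncomputable def GraphOrientation.wStarMax [Nonempty V] {G : SimpleGraph V}
    (Λ : GraphOrientation G) (w : V → ℝ) : ℝ :=
  univ.sup' univ_nonempty (Λ.wStarVal w)

/-- The weighted min-max indegree number `k*(G)`. -/
noncomputable def wKStar [Nonempty V] (G : SimpleGraph V) (w : V → ℝ) : ℝ :=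
  sInf {r | ∃ Λ : GraphOrientation G, Λ.wIndegMax w = r}

/-- The weighted min-max star partitioning number `x*(G)`. -/
noncomputable def wXStar [Nonempty V] (G : SimpleGraph V) (w : V → ℝ) : ℝ :=
  sInf {r | ∃ Λ : GraphOrientation G, Λ.wStarMax w = r}

namespace GraphOrientation

variable {G : SimpleGraph V}

instance : Nonempty (GraphOrientation G) := by
  classical
  let e := Fintype.equivFin V
  refine ⟨⟨fun u v => decide (G.Adj u v ∧ e u < e v), fun u v h => ?_, fun u v h => ?_⟩⟩
  · exact (of_decide_eq_true h).1
  · have hne : e u ≠ e v := fun h' => h.ne (e.injective h')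
    simp only [decide_eq_true_eq, decide_eq_false_iff_not, h, h.symm, true_and, not_lt]
    exact ⟨le_of_lt, fun hle => lt_of_le_of_ne hle hne⟩

lemma wIndeg_nonneg (Λ : GraphOrientation G) {w : V → ℝ} (hw : ∀ v, 0 ≤ w v) (v : V) :
    0 ≤ Λ.wIndeg w v :=
  sum_nonneg fun u _ => hw u

lemma wIndeg_le_wStarVal (Λ : GraphOrientation G) {w : V → ℝ} (hw : ∀ v, 0 ≤ w v) (v : V) :
    Λ.wIndeg w v ≤ Λ.wStarVal w v := by
  unfold wStarVal
  split_ifs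
  · exact le_add_of_nonneg_right (hw v)
  · simp

variable [Nonempty V]

lemma wIndeg_le_wIndegMax (Λ : GraphOrientation G) (w : V → ℝ) (v : V) :
    Λ.wIndeg w v ≤ Λ.wIndegMax w :=
  le_sup' (Λ.wIndeg w) (mem_univ v)

lemma wIndegMax_nonneg (Λ : GraphOrientation G) {w : V → ℝ} (hw : ∀ v, 0 ≤ w v) :
    0 ≤ Λ.wIndegMax w :=
  (Λ.wIndeg_nonneg hw (Classical.arbitrary V)).trans (Λ.wIndeg_le_wIndegMax w _)

lemma wIndegMax_le_wStarMax (Λ : GraphOrientation G) {w : V → ℝ} (hw : ∀ v, 0 ≤ w v) :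
    Λ.wIndegMax w ≤ Λ.wStarMax w :=
  sup'_le _ _ fun v _ =>
    (Λ.wIndeg_le_wStarVal hw v).trans (le_sup' (Λ.wStarVal w) (mem_univ v))

/-- The weight of a vertex with an outgoing edge is counted at the head of that edge. -/
lemma weight_le_wIndegMax (Λ : GraphOrientation G) {w : V → ℝ} (hw : ∀ v, 0 ≤ w v) {v : V}
    (hv : 0 < Λ.outdeg v) : w v ≤ Λ.wIndegMax w := by
  obtain ⟨u, hu⟩ := card_pos.mp hv
  have hvu : Λ.dir v u = true := (mem_filter.mp hu).2
  calc w v ≤ Λ.wIndeg w u :=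
        single_le_sum (fun i _ => hw i) (mem_filter.mpr ⟨mem_univ v, hvu⟩)
    _ ≤ Λ.wIndegMax w := Λ.wIndeg_le_wIndegMax w u

lemma wStarMax_le_two_mul_wIndegMax (Λ : GraphOrientation G) {w : V → ℝ}
    (hw : ∀ v, 0 ≤ w v) : Λ.wStarMax w ≤ 2 * Λ.wIndegMax w := by
  refine sup'_le _ _ fun v _ => ?_
  rw [two_mul]
  refine add_le_add (Λ.wIndeg_le_wIndegMax w v) ?_
  split_ifs with hv
  · exact Λ.weight_le_wIndegMax hw hv
  · exact Λ.wIndegMax_nonneg hw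

lemma wKStar_le_wIndegMax (Λ : GraphOrientation G) {w : V → ℝ} (hw : ∀ v, 0 ≤ w v) :
    wKStar G w ≤ Λ.wIndegMax w := by
  refine csInf_le ⟨0, ?_⟩ ⟨Λ, rfl⟩
  rintro _ ⟨Λ', rfl⟩
  exact Λ'.wIndegMax_nonneg hw

lemma wXStar_le_wStarMax (Λ : GraphOrientation G) {w : V → ℝ} (hw : ∀ v, 0 ≤ w v) :
    wXStar G w ≤ Λ.wStarMax w := by
  refine csInf_le ⟨0, ?_⟩ ⟨Λ, rfl⟩
  rintro _ ⟨Λ', rfl⟩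
  exact (Λ'.wIndegMax_nonneg hw).trans (Λ'.wIndegMax_le_wStarMax hw)

end GraphOrientation

/-- For positive vertex weights, `k*(G) ≤ x*(G) ≤ 2 · k*(G)`. -/
theorem stmt11 [Nonempty V] (G : SimpleGraph V) (w : V → ℝ) (hw : ∀ v, 0 < w v) :
    wKStar G w ≤ wXStar G w ∧ wXStar G w ≤ 2 * wKStar G w := by
  have hw₀ : ∀ v, 0 ≤ w v := fun v => (hw v).le
  obtain ⟨Λ₀⟩ : Nonempty (GraphOrientation G) := inferInstance
  constructor
  · refine le_csInf ⟨_, Λ₀, rfl⟩ ?_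
    rintro _ ⟨Λ, rfl⟩
    exact (Λ.wKStar_le_wIndegMax hw₀).trans (Λ.wIndegMax_le_wStarMax hw₀)
  · suffices wXStar G w / 2 ≤ wKStar G w by linarith
    refine le_csInf ⟨_, Λ₀, rfl⟩ ?_
    rintro _ ⟨Λ, rfl⟩
    linarith [Λ.wXStar_le_wStarMax hw₀, Λ.wStarMax_le_two_mul_wIndegMax hw₀]
end

section
/- Let s_1, …, s_n be positive reals (item sizes), let K ≥ 2 be an integer (number of bins), and let c > 0 be a real (bin capacity). Let G_B be the complete bipartite graph whose parts are item-vertices a_1, …, a_n with weights w_{a_i} = s_i and bin-vertices b_1, …, b_K each with weight c/(K−1). Then the items can be partitioned into K sets I_1, …, I_K with Σ_{i ∈ I_j} s_i ≤ c for every j if and only if there exists an orientation Λ of G_B such that the weighted indegree k(G_B,Λ,v) ≤ c for every vertex v. -/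
open Finset

variable {V : Type*} [Fintype V]

namespace GraphOrientation

variable {A B : Type*} [Fintype A] [Fintype B]

/-- The weighted indegree of a left vertex counts only right vertices. -/
lemma wIndeg_inl (Λ : GraphOrientation (completeBipartiteGraph A B)) (w : A ⊕ B → ℝ) (a : A) :
    Λ.wIndeg w (.inl a) =
      ∑ b ∈ univ.filter (fun b => Λ.dir (.inr b) (.inl a) = true), w (.inr b) := by
  have h : ∀ a' : A, Λ.dir (.inl a') (.inl a) = false := fun a' => by
    simpa using mt (Λ.adj_of_dir (.inl a') (.inl a)) (by simp)
  simp [wIndeg, sum_filter, h]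

/-- The weighted indegree of a right vertex counts only left vertices. -/
lemma wIndeg_inr (Λ : GraphOrientation (completeBipartiteGraph A B)) (w : A ⊕ B → ℝ) (b : B) :
    Λ.wIndeg w (.inr b) =
      ∑ a ∈ univ.filter (fun a => Λ.dir (.inl a) (.inr b) = true), w (.inl a) := by
  have h : ∀ b' : B, Λ.dir (.inr b') (.inr b) = false := fun b' => by
    simpa using mt (Λ.adj_of_dir (.inr b') (.inr b)) (by simp)
  simp [wIndeg, sum_filter, h]

/-- The orientation of the complete bipartite graph induced by a map `f : A → B`: the edge at
`a` and `f a` leaves `a`, all other edges at `a` enter it. -/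
def ofMap [DecidableEq B] (f : A → B) : GraphOrientation (completeBipartiteGraph A B) where
  dir
    | .inl a, .inr b => decide (f a = b)
    | .inr b, .inl a => decide (f a ≠ b)
    | _, _ => false
  adj_of_dir := by rintro (a | b) (a' | b') <;> simp
  dir_iff := by rintro (a | b) (a' | b') <;> simp

end GraphOrientation

/-- Bin packing with item sizes `s`, `K ≥ 2` bins and capacity `c` is
feasible iff the complete bipartite graph on items and bins, with item weights `s i`
and bin weights `c/(K-1)`, admits an orientation with all weighted indegrees at most `c`. -/
theorem stmt12 (n K : ℕ) (hK : 2 ≤ K) (s : Fin n → ℝ) (hs : ∀ i, 0 < s i)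
    (c : ℝ) (hc : 0 < c) :
    (∃ f : Fin n → Fin K, ∀ j : Fin K,
        ∑ i ∈ univ.filter (fun i => f i = j), s i ≤ c) ↔
      ∃ Λ : GraphOrientation (completeBipartiteGraph (Fin n) (Fin K)),
        ∀ v, Λ.wIndeg (Sum.elim s (fun _ => c / ((K : ℝ) - 1))) v ≤ c := by
  have hK' : (0 : ℝ) < K - 1 := by
    have : (2 : ℝ) ≤ K := by exact_mod_cast hK
    linarith
  constructor
  · rintro ⟨f, hf⟩
    refine ⟨.ofMap f, ?_⟩
    rintro (i | j)
    · have hcard : ((univ.filter fun j => f i ≠ j).card : ℝ) = K - 1 := by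
        rw [filter_ne, card_erase_of_mem (mem_univ _), card_univ, Fintype.card_fin,
          Nat.cast_pred (by omega)]
      rw [GraphOrientation.wIndeg_inl]
      simp only [GraphOrientation.ofMap, decide_eq_true_eq, Sum.elim_inr, sum_const,
        nsmul_eq_mul, hcard]
      exact (mul_div_cancel₀ c hK'.ne').le
    · rw [GraphOrientation.wIndeg_inr]
      simpa [GraphOrientation.ofMap] using hf j
  · rintro ⟨Λ, hΛ⟩
    have hout : ∀ i, ∃ j, Λ.dir (.inl i) (.inr j) = true := by
      intro i
      by_contra! hno
      have hin : ∀ j, Λ.dir (.inr j) (.inl i) = true := fun j =>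
        (Λ.dir_iff (.inr j) (.inl i) (by simp)).2 (by simpa using hno j)
      have hle := hΛ (.inl i)
      simp only [GraphOrientation.wIndeg_inl, hin, filter_true, Sum.elim_inr, sum_const,
        card_univ, Fintype.card_fin, nsmul_eq_mul] at hle
      rw [mul_div_assoc', div_le_iff₀ hK'] at hle
      linarith
    choose f hf using hout
    refine ⟨f, fun j => le_trans ?_ (hΛ (.inr j))⟩
    rw [GraphOrientation.wIndeg_inr]
    refine sum_le_sum_of_subset_of_nonneg (fun i hi => ?_) fun i _ _ => (hs i).le
    obtain rfl : f i = j := by simpa using hi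
    simpa using hf i
end
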